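/- For every n ≥ 2, every maximal independent set M of the thin grid cylinder T_{3×n} intersects each slice in exactly one vertex; that is, for every i with 1 ≤ i ≤ n, the set of vertices of M whose second coordinate is i has cardinality exactly 1. -/

import Mathlib

open SimpleGraph Finset

/-- A maximal independent set of a simple graph, as a `Finset` of vertices. -/
def IsMaxIndep {V : Type*} (G : SimpleGraph V) (s : Finset V) : Prop :=
  (∀ ⦃u⦄, u ∈ s → ∀ ⦃v⦄, v ∈ s → ¬ G.Adj u v) ∧
  ∀ t : Finset V, (∀ ⦃u⦄, u ∈ t → ∀ ⦃v⦄, v ∈ t → ¬ G.Adj u v) → s ⊆ t → s = t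

/-- The finite set of all maximal independent sets of `G`. -/
noncomputable def misFinset {V : Type*} [Fintype V] (G : SimpleGraph V) : Finset (Finset V) := by
  classical exact Finset.univ.filter (IsMaxIndep G)

/-- The number of orbits of maximal independent sets of `G` under the action of the
automorphism group of `G`. -/
noncomputable def nimisCard {V : Type*} [Fintype V] [DecidableEq V] (G : SimpleGraph V) : ℕ :=
  Nat.card (Quot (fun M N : {s : Finset V // IsMaxIndep G s} =>
    ∃ e : G ≃g G, (M : Finset V).image e = (N : Finset V)))

/-- The grid graph `G_{m×n}`, the box product of two path graphs. -/
def gridGraph (m n : ℕ) : SimpleGraph (Fin m × Fin n) := pathGraph m □ pathGraph n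

/-- The thin grid cylinder `T_{m×n}`, the box product of a cycle graph and a path graph. -/
def thinCylinder (m n : ℕ) : SimpleGraph (Fin m × Fin n) := cycleGraph m □ pathGraph n

/-- A maximal independent set is dominating. -/
lemma IsMaxIndep.exists_adj {V : Type*} {G : SimpleGraph V} {s : Finset V}
    (hs : IsMaxIndep G s) {v : V} (hv : v ∉ s) : ∃ u ∈ s, G.Adj u v := by
  classical
  by_contra! h
  refine hv ?_
  rw [hs.2 (insert v s) ?_ (Finset.subset_insert v s)]
  · exact Finset.mem_insert_self v s
  · intro a ha b hb hab
    rcases Finset.mem_insert.1 ha with rfl | has <;> rcases Finset.mem_insert.1 hb with rfl | hbs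
    · exact hab.ne rfl
    · exact h b hbs hab.symm
    · exact h a has hab
    · exact hs.1 has hbs hab

/-- Every slice of the thin grid cylinder over a triangle is a clique. -/
lemma thinCylinder_three_adj_of_ne {n : ℕ} {a b : Fin 3} (hab : a ≠ b) (i : Fin n) :
    (thinCylinder 3 n).Adj (a, i) (b, i) := by
  simp [thinCylinder, boxProd_adj, cycleGraph_three_eq_top, hab]

theorem mis_thinCylinder_slice_unique (n : ℕ) (hn : 2 ≤ n)
    (M : Finset (Fin 3 × Fin n)) (hM : IsMaxIndep (thinCylinder 3 n) M) :
    ∀ i : Fin n, (M.filter (fun p => p.2 = i)).card = 1 := by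
  have uniq : ∀ {a b : Fin 3} {i j : Fin n}, (a, i) ∈ M → (b, j) ∈ M → i.val = j.val → a = b := by
    intro a b i j ha hb hij
    obtain rfl := Fin.ext hij
    by_contra hab
    exact hM.1 ha hb (thinCylinder_three_adj_of_ne hab i)
  intro i
  apply le_antisymm
  · rw [Finset.card_le_one]
    rintro ⟨a, j⟩ ha ⟨b, k⟩ hb
    simp only [Finset.mem_filter] at ha hb
    obtain ⟨ha, rfl⟩ := ha
    obtain ⟨hb, rfl⟩ := hb
    rw [uniq ha hb rfl]
  · rw [Nat.one_le_iff_ne_zero, Finset.card_ne_zero]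
    by_contra hempty
    have hi : ∀ a : Fin 3, (a, i) ∉ M := fun a ha =>
      hempty ⟨(a, i), Finset.mem_filter.2 ⟨ha, rfl⟩⟩
    have dom : ∀ a : Fin 3, ∃ j : Fin n, (a, j) ∈ M ∧ (j.val + 1 = i.val ∨ i.val + 1 = j.val) := by
      intro a
      obtain ⟨⟨b, j⟩, hb, hadj⟩ := hM.exists_adj (hi a)
      rw [thinCylinder, boxProd_adj] at hadj
      rcases hadj with ⟨-, hj⟩ | ⟨hj, hba⟩
      · exact absurd ((show j = i from hj) ▸ hb) (hi b)
      · exact ⟨j, (show b = a from hba) ▸ hb, pathGraph_adj.1 hj⟩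
    choose f hf hadj using dom
    have sep : ∀ a b : Fin 3, a ≠ b → (f a).val ≠ (f b).val :=
      fun a b hab h => hab (uniq (hf a) (hf b) h)
    have h01 := sep 0 1 (by decide)
    have h02 := sep 0 2 (by decide)
    have h12 := sep 1 2 (by decide)
    have h0 := hadj 0
    have h1 := hadj 1
    have h2 := hadj 2
    omega
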